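/- arXiv:0809.2139 — 2 statements merged into one kernel-verified Lean document; each statement's English description precedes it below -/
import Mathlib

section
/- Let p be an odd prime, let k ≥ 2, and let g be an integer that is a primitive root modulo p^k. Then for every integer t with 0 ≤ t ≤ p − 1, one has (g + t·p^k)^{φ(p^k)} ≢ 1 (mod p^{k+1}). -/
/-- `a` is a primitive root modulo `n`: `gcd(a, n) = 1` and the multiplicative
order of `a` modulo `n` equals `φ(n)`. -/
def IsPrimitiveRootMod (n : ℕ) (a : ℤ) : Prop :=
  Int.gcd a n = 1 ∧ orderOf (a : ZMod n) = Nat.totient n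

/-- The case `y = 1`, `n = p` of lifting the exponent, as a descent of divisibility. -/
theorem pow_dvd_sub_one_of_pow_succ_dvd_pow_sub_one {p : ℕ} (hp : p.Prime) (hodd : Odd p)
    {b : ℤ} (hb : (p : ℤ) ∣ b - 1) {k : ℕ} (h : (p : ℤ) ^ (k + 1) ∣ b ^ p - 1) :
    (p : ℤ) ^ k ∣ b - 1 := by
  have hpb : ¬ (p : ℤ) ∣ b := fun hdvd =>
    (Nat.prime_iff_prime_int.mp hp).not_dvd_one (by simpa using dvd_sub hdvd hb)
  have lte := Int.emultiplicity_pow_sub_pow hp hodd hb hpb p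
  rw [one_pow, (Nat.finiteMultiplicity_iff.mpr
    ⟨hp.ne_one, hp.pos⟩).emultiplicity_self] at lte
  rw [pow_dvd_iff_le_emultiplicity] at h ⊢
  rw [lte] at h
  push_cast at h
  exact (ENat.add_le_add_iff_right ENat.one_ne_top).mp h

theorem stmt_4 (p k : ℕ) (hp : p.Prime) (hodd : Odd p) (hk : 2 ≤ k)
    (g : ℤ) (hg : IsPrimitiveRootMod (p ^ k) g) :
    ∀ t : ℤ, 0 ≤ t → t ≤ (p : ℤ) - 1 →
      ¬ ((g + t * (p : ℤ) ^ k) ^ Nat.totient (p ^ k) ≡ 1 [ZMOD ((p : ℤ) ^ (k + 1))]) := by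
  intro t _ _ h
  obtain ⟨hcop, hord⟩ := hg
  obtain ⟨m, rfl⟩ := Nat.exists_eq_add_of_le' hk
  set a : ℤ := g + t * (p : ℤ) ^ (m + 2) with ha
  have hag : (a : ZMod (p ^ (m + 2))) = g := by
    have hzero : (p : ZMod (p ^ (m + 2))) ^ (m + 2) = 0 := by
      rw [← Nat.cast_pow, ZMod.natCast_self]
    simp [ha, hzero]
  have hgp : IsCoprime g (p : ℤ) := by
    rw [← Int.isCoprime_iff_gcd_eq_one, Nat.cast_pow] at hcop
    exact (IsCoprime.pow_right_iff (by omega)).mp hcop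
  have hap : IsCoprime a (p : ℤ) := by
    rw [ha, pow_succ, ← mul_assoc]
    exact hgp.add_mul_right_left _
  have htot : Nat.totient (p ^ (m + 2)) = (p - 1) * p ^ m * p := by
    rw [Nat.totient_prime_pow_succ hp]; ring
  have hb : (p : ℤ) ∣ a ^ ((p - 1) * p ^ m) - 1 := by
    have hmod := (Int.ModEq.pow_card_sub_one_eq_one hp hap).pow (p ^ m)
    rw [← pow_mul, one_pow] at hmod
    exact hmod.symm.dvd
  rw [htot, pow_mul] at h
  have hdvd := pow_dvd_sub_one_of_pow_succ_dvd_pow_sub_one hp hodd hb h.symm.dvd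
  have hone : (g : ZMod (p ^ (m + 2))) ^ ((p - 1) * p ^ m) = 1 := by
    rw [← hag, ← sub_eq_zero]
    exact_mod_cast (ZMod.intCast_zmod_eq_zero_iff_dvd _ _).mpr (by exact_mod_cast hdvd)
  have hpos : 0 < (p - 1) * p ^ m := Nat.mul_pos (Nat.sub_pos_of_lt hp.one_lt) (pow_pos hp.pos m)
  have hle := orderOf_le_of_pow_eq_one hpos hone
  rw [hord, htot] at hle
  exact absurd hle (not_le.mpr (lt_mul_of_one_lt_right hpos hp.one_lt))
end

section
/- Let p be a prime and let g be an integer that is a primitive root modulo p. Then there is exactly one integer t with 0 ≤ t ≤ p − 1 such that g + t·p is NOT a primitive root modulo p^2; for all other values of t in this range, g + t·p is a primitive root modulo p^2. -/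
theorem IsPrimitiveRootMod.of_dvd_sub {n : ℕ} {a b : ℤ} (ha : IsPrimitiveRootMod n a)
    (h : (n : ℤ) ∣ b - a) : IsPrimitiveRootMod n b := by
  have hcast : (a : ZMod n) = b := (ZMod.intCast_eq_intCast_iff_dvd_sub a b n).2 h
  refine ⟨?_, hcast ▸ ha.2⟩
  obtain ⟨c, hc⟩ := h
  obtain rfl : b = a + n * c := by linarith
  simpa using ha.1

theorem orderOf_intCast_dvd_totient {n : ℕ} {a : ℤ} (ha : Int.gcd a n = 1) :
    orderOf (a : ZMod n) ∣ n.totient := by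
  obtain ⟨u, hu⟩ := (ZMod.coe_int_isUnit_iff_isCoprime a n).2
    (Int.isCoprime_iff_gcd_eq_one.2 ha).symm
  rw [← hu, orderOf_dvd_iff_pow_eq_one, ← Units.val_pow_eq_pow_val, ZMod.pow_totient,
    Units.val_one]

/-- A primitive root modulo `p` fails to be one modulo `p ^ 2` exactly when it is fixed by
`x ↦ x ^ p` modulo `p ^ 2`. -/
theorem not_isPrimitiveRootMod_sq_iff {p : ℕ} (hp : p.Prime) {a : ℤ}
    (ha : IsPrimitiveRootMod p a) :
    ¬ IsPrimitiveRootMod (p ^ 2) a ↔ (p : ℤ) ^ 2 ∣ a ^ p - a := by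
  have hcop : IsCoprime a ((p : ℤ) ^ 2) := (Int.isCoprime_iff_gcd_eq_one.2 ha.1).pow_right
  have hgcd : Int.gcd a ((p ^ 2 : ℕ) : ℤ) = 1 := by
    rw [← Int.isCoprime_iff_gcd_eq_one]
    exact_mod_cast hcop
  have htot : (p ^ 2).totient = (p - 1) * p := by
    rw [Nat.totient_prime_pow hp two_pos, mul_comm]
    simp
  have hpow : (p : ℤ) ^ 2 ∣ a ^ p - a ↔ (a : ZMod (p ^ 2)) ^ (p - 1) = 1 := by
    have hfac : a ^ p - a = a * (a ^ (p - 1) - 1) := by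
      rw [mul_sub, mul_one, mul_pow_sub_one hp.ne_zero]
    have hcast := ZMod.intCast_eq_intCast_iff_dvd_sub 1 (a ^ (p - 1)) (p ^ 2)
    push_cast at hcast
    rw [eq_comm, hcast, hfac]
    exact ⟨hcop.symm.dvd_of_dvd_mul_left, fun h => h.mul_left a⟩
  have hdvd : p - 1 ∣ orderOf (a : ZMod (p ^ 2)) := by
    have h := orderOf_map_dvd
      (ZMod.castHom (dvd_pow_self p two_ne_zero) (ZMod p) : ZMod (p ^ 2) →* ZMod p) a
    rwa [MonoidHom.coe_coe, map_intCast, ha.2, Nat.totient_prime hp] at h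
  have hpos : 0 < p - 1 := Nat.sub_pos_of_lt hp.one_lt
  have hle := orderOf_intCast_dvd_totient hgcd
  rw [hpow, ← orderOf_dvd_iff_pow_eq_one, IsPrimitiveRootMod, htot, and_iff_right hgcd]
  rw [htot] at hle
  obtain ⟨k, hk⟩ := hdvd
  rw [hk] at hle ⊢
  rw [Nat.mul_right_inj hpos.ne']
  have hone : (p - 1) * k ∣ p - 1 ↔ k = 1 := by
    conv_lhs => rhs; rw [← mul_one (p - 1)]
    rw [Nat.mul_dvd_mul_iff_left hpos, Nat.dvd_one]
  rw [hone]
  rcases (Nat.dvd_prime hp).1 (Nat.dvd_of_mul_dvd_mul_left hpos hle) with rfl | rfl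
  · simp [hp.ne_one.symm]
  · simp [hp.ne_one]

theorem stmt_7 (p : ℕ) (hp : p.Prime) (g : ℤ) (hg : IsPrimitiveRootMod p g) :
    ∃! t : ℤ, 0 ≤ t ∧ t ≤ (p : ℤ) - 1 ∧ ¬ IsPrimitiveRootMod (p ^ 2) (g + t * p) := by
  have := Fact.mk hp
  have hp0 : (0 : ℤ) < p := by exact_mod_cast hp.pos
  obtain ⟨c, hc⟩ : (p : ℤ) ∣ g ^ p - g := by
    have h := ZMod.intCast_eq_intCast_iff_dvd_sub g (g ^ p) p
    rw [← h]
    simp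
  have key (t : ℤ) : ¬ IsPrimitiveRootMod (p ^ 2) (g + t * p) ↔ (p : ℤ) ∣ c - t := by
    rw [not_isPrimitiveRootMod_sq_iff hp (hg.of_dvd_sub (by simp))]
    have hpow : (p : ℤ) ^ 2 ∣ (g + t * p) ^ p - g ^ p := by
      simpa using dvd_sub_pow_of_dvd_sub (p := p) (a := g + t * p) (b := g) (by simp) 1
    have hsplit : (g + t * p) ^ p - (g + t * p) =
        ((g + t * p) ^ p - g ^ p) + p * (c - t) := by linear_combination hc
    rw [hsplit, dvd_add_right hpow, sq, mul_dvd_mul_iff_left hp0.ne']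
  simp only [key]
  refine ⟨c % p, ⟨Int.emod_nonneg _ hp0.ne', Int.le_sub_one_of_lt (Int.emod_lt_of_pos _ hp0),
    Int.dvd_self_sub_emod⟩, ?_⟩
  rintro t ⟨ht0, htp, ht⟩
  rw [← Int.emod_eq_of_lt ht0 (Int.lt_of_le_sub_one htp)]
  exact Int.modEq_iff_dvd.2 ht
end
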